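/- A vector x* ∈ ℝⁿ is a strict local-nonglobal minimizer of (GTRE) if and only if the following three conditions hold: (i) f₁(x*) = 0; (ii) there exists μ* ∈ ℝ such that (A₀x* + b₀) + μ*(A₁x* + b₁) = 0, vᵀ(A₀ + μ*A₁)v > 0 for every nonzero v ∈ ℝⁿ with (A₁x* + b₁)ᵀv = 0, and A₀ + μ*A₁ is not positive semidefinite; (iii) A₁ ≠ 0. -/

import Mathlib

open Matrix Finset

/-- Euclidean norm of a vector in `Fin n → ℝ`. -/
noncomputable def euclNorm {n : ℕ} (x : Fin n → ℝ) : ℝ := Real.sqrt (x ⬝ᵥ x)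

/-- Objective `f₀(x) = xᵀA₀x + 2b₀ᵀx`. -/
noncomputable def qf0 {n : ℕ} (A0 : Matrix (Fin n) (Fin n) ℝ) (b0 : Fin n → ℝ)
    (x : Fin n → ℝ) : ℝ := x ⬝ᵥ A0.mulVec x + 2 * (b0 ⬝ᵥ x)

/-- Constraint `f₁(x) = xᵀA₁x + 2b₁ᵀx + c₁`. -/
noncomputable def qf1 {n : ℕ} (A1 : Matrix (Fin n) (Fin n) ℝ) (b1 : Fin n → ℝ) (c1 : ℝ)
    (x : Fin n → ℝ) : ℝ := x ⬝ᵥ A1.mulVec x + 2 * (b1 ⬝ᵥ x) + c1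

/-- Local minimizer of (GTRE): feasible, and locally optimal among feasible points. -/
def IsLocalMinGTRE {n : ℕ} (A0 A1 : Matrix (Fin n) (Fin n) ℝ) (b0 b1 : Fin n → ℝ) (c1 : ℝ)
    (xs : Fin n → ℝ) : Prop :=
  qf1 A1 b1 c1 xs = 0 ∧ ∃ δ > (0:ℝ), ∀ x : Fin n → ℝ,
    qf1 A1 b1 c1 x = 0 → euclNorm (x - xs) < δ → qf0 A0 b0 xs ≤ qf0 A0 b0 x

/-- Global minimizer of (GTRE). -/
def IsGlobalMinGTRE {n : ℕ} (A0 A1 : Matrix (Fin n) (Fin n) ℝ) (b0 b1 : Fin n → ℝ) (c1 : ℝ)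
    (xs : Fin n → ℝ) : Prop :=
  qf1 A1 b1 c1 xs = 0 ∧ ∀ x : Fin n → ℝ, qf1 A1 b1 c1 x = 0 → qf0 A0 b0 xs ≤ qf0 A0 b0 x

/-- Local-nonglobal minimizer of (GTRE). -/
def IsLNGMinGTRE {n : ℕ} (A0 A1 : Matrix (Fin n) (Fin n) ℝ) (b0 b1 : Fin n → ℝ) (c1 : ℝ)
    (xs : Fin n → ℝ) : Prop :=
  IsLocalMinGTRE A0 A1 b0 b1 c1 xs ∧ ¬ IsGlobalMinGTRE A0 A1 b0 b1 c1 xs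

/-- Strict local minimizer of (GTRE). -/
def IsStrictLocalMinGTRE {n : ℕ} (A0 A1 : Matrix (Fin n) (Fin n) ℝ) (b0 b1 : Fin n → ℝ)
    (c1 : ℝ) (xs : Fin n → ℝ) : Prop :=
  qf1 A1 b1 c1 xs = 0 ∧ ∃ δ > (0:ℝ), ∀ x : Fin n → ℝ,
    qf1 A1 b1 c1 x = 0 → x ≠ xs → euclNorm (x - xs) < δ → qf0 A0 b0 xs < qf0 A0 b0 x

/-- Strict local-nonglobal minimizer of (GTRE). -/
def IsStrictLNGMinGTRE {n : ℕ} (A0 A1 : Matrix (Fin n) (Fin n) ℝ) (b0 b1 : Fin n → ℝ)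
    (c1 : ℝ) (xs : Fin n → ℝ) : Prop :=
  IsStrictLocalMinGTRE A0 A1 b0 b1 c1 xs ∧ ¬ IsGlobalMinGTRE A0 A1 b0 b1 c1 xs

/-- Local minimizer of (GTR). -/
def IsLocalMinGTR {n : ℕ} (A0 A1 : Matrix (Fin n) (Fin n) ℝ) (b0 b1 : Fin n → ℝ) (c1 : ℝ)
    (xs : Fin n → ℝ) : Prop :=
  qf1 A1 b1 c1 xs ≤ 0 ∧ ∃ δ > (0:ℝ), ∀ x : Fin n → ℝ,
    qf1 A1 b1 c1 x ≤ 0 → euclNorm (x - xs) < δ → qf0 A0 b0 xs ≤ qf0 A0 b0 x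

/-- Global minimizer of (GTR). -/
def IsGlobalMinGTR {n : ℕ} (A0 A1 : Matrix (Fin n) (Fin n) ℝ) (b0 b1 : Fin n → ℝ) (c1 : ℝ)
    (xs : Fin n → ℝ) : Prop :=
  qf1 A1 b1 c1 xs ≤ 0 ∧ ∀ x : Fin n → ℝ, qf1 A1 b1 c1 x ≤ 0 → qf0 A0 b0 xs ≤ qf0 A0 b0 x

/-- Local-nonglobal minimizer of (GTR). -/
def IsLNGMinGTR {n : ℕ} (A0 A1 : Matrix (Fin n) (Fin n) ℝ) (b0 b1 : Fin n → ℝ) (c1 : ℝ)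
    (xs : Fin n → ℝ) : Prop :=
  IsLocalMinGTR A0 A1 b0 b1 c1 xs ∧ ¬ IsGlobalMinGTR A0 A1 b0 b1 c1 xs

/-- Strict local minimizer of (GTR). -/
def IsStrictLocalMinGTR {n : ℕ} (A0 A1 : Matrix (Fin n) (Fin n) ℝ) (b0 b1 : Fin n → ℝ)
    (c1 : ℝ) (xs : Fin n → ℝ) : Prop :=
  qf1 A1 b1 c1 xs ≤ 0 ∧ ∃ δ > (0:ℝ), ∀ x : Fin n → ℝ,
    qf1 A1 b1 c1 x ≤ 0 → x ≠ xs → euclNorm (x - xs) < δ → qf0 A0 b0 xs < qf0 A0 b0 x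

/-- Strict local-nonglobal minimizer of (GTR). -/
def IsStrictLNGMinGTR {n : ℕ} (A0 A1 : Matrix (Fin n) (Fin n) ℝ) (b0 b1 : Fin n → ℝ)
    (c1 : ℝ) (xs : Fin n → ℝ) : Prop :=
  IsStrictLocalMinGTR A0 A1 b0 b1 c1 xs ∧ ¬ IsGlobalMinGTR A0 A1 b0 b1 c1 xs

open Filter Topology

section QuadraticForms

variable {n : ℕ}

lemma Matrix.IsSymm.dotProduct_mulVec_comm {A : Matrix (Fin n) (Fin n) ℝ} (hA : A.IsSymm)
    (x y : Fin n → ℝ) : x ⬝ᵥ A *ᵥ y = y ⬝ᵥ A *ᵥ x := by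
  rw [← dotProduct_transpose_mulVec, hA.eq]

lemma Matrix.IsSymm.quadForm_add_smul {A : Matrix (Fin n) (Fin n) ℝ} (hA : A.IsSymm)
    (v u : Fin n → ℝ) (ε : ℝ) :
    (v + ε • u) ⬝ᵥ A *ᵥ (v + ε • u)
      = v ⬝ᵥ A *ᵥ v + 2 * ε * (v ⬝ᵥ A *ᵥ u) + ε ^ 2 * (u ⬝ᵥ A *ᵥ u) := by
  simp only [mulVec_add, mulVec_smul, dotProduct_add, add_dotProduct, dotProduct_smul,
    smul_dotProduct, smul_eq_mul, hA.dotProduct_mulVec_comm u v]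
  ring

lemma quadForm_smul (A : Matrix (Fin n) (Fin n) ℝ) (r : ℝ) (d : Fin n → ℝ) :
    (r • d) ⬝ᵥ A *ᵥ (r • d) = r ^ 2 * (d ⬝ᵥ A *ᵥ d) := by
  simp only [mulVec_smul, dotProduct_smul, smul_dotProduct, smul_eq_mul]
  ring

lemma quadForm_add_smul_matrix (A B : Matrix (Fin n) (Fin n) ℝ) (μ : ℝ) (x : Fin n → ℝ) :
    x ⬝ᵥ (A + μ • B) *ᵥ x = x ⬝ᵥ A *ᵥ x + μ * (x ⬝ᵥ B *ᵥ x) := by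
  simp [add_mulVec, smul_mulVec]

@[fun_prop]
lemma continuous_quadForm (A : Matrix (Fin n) (Fin n) ℝ) :
    Continuous fun x : Fin n → ℝ => x ⬝ᵥ A *ᵥ x :=
  continuous_id.dotProduct (continuous_const.matrix_mulVec continuous_id)

lemma qf1_add {A : Matrix (Fin n) (Fin n) ℝ} (hA : A.IsSymm) (b : Fin n → ℝ) (c : ℝ)
    (x y : Fin n → ℝ) :
    qf1 A b c (x + y) = qf1 A b c x + (y ⬝ᵥ A *ᵥ y + 2 * ((A *ᵥ x + b) ⬝ᵥ y)) := by
  simp only [qf1, mulVec_add, dotProduct_add, add_dotProduct, hA.dotProduct_mulVec_comm x y,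
    dotProduct_comm (A *ᵥ x) y]
  ring

lemma qf0_add {A : Matrix (Fin n) (Fin n) ℝ} (hA : A.IsSymm) (b x y : Fin n → ℝ) :
    qf0 A b (x + y) = qf0 A b x + (y ⬝ᵥ A *ᵥ y + 2 * ((A *ᵥ x + b) ⬝ᵥ y)) := by
  simpa [qf1, qf0] using qf1_add hA b 0 x y

lemma Matrix.IsSymm.posSemidef_iff {A : Matrix (Fin n) (Fin n) ℝ} (hA : A.IsSymm) :
    A.PosSemidef ↔ ∀ x, 0 ≤ x ⬝ᵥ A *ᵥ x := by
  rw [posSemidef_iff_dotProduct_mulVec]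
  simp [IsHermitian, hA.eq, conjTranspose_eq_transpose_of_trivial]

lemma continuous_euclNorm : Continuous (euclNorm : (Fin n → ℝ) → ℝ) :=
  Real.continuous_sqrt.comp (continuous_id.dotProduct continuous_id)

lemma norm_le_euclNorm (x : Fin n → ℝ) : ‖x‖ ≤ euclNorm x := by
  refine (pi_norm_le_iff_of_nonneg (Real.sqrt_nonneg _)).2 fun i => ?_
  refine Real.abs_le_sqrt ?_
  rw [dotProduct, sq]
  exact Finset.single_le_sum (f := fun i => x i * x i) (fun j _ => mul_self_nonneg _)
    (Finset.mem_univ i)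

lemma isStrictLocalMinGTRE_iff {A0 A1 : Matrix (Fin n) (Fin n) ℝ} (hA0 : A0.IsSymm)
    (hA1 : A1.IsSymm) (b0 b1 : Fin n → ℝ) (c1 : ℝ) (xs : Fin n → ℝ) :
    IsStrictLocalMinGTRE A0 A1 b0 b1 c1 xs ↔ qf1 A1 b1 c1 xs = 0 ∧
      ∀ᶠ y in 𝓝 (0 : Fin n → ℝ), y ⬝ᵥ A1 *ᵥ y + 2 * ((A1 *ᵥ xs + b1) ⬝ᵥ y) = 0 → y ≠ 0 →
        0 < y ⬝ᵥ A0 *ᵥ y + 2 * ((A0 *ᵥ xs + b0) ⬝ᵥ y) := by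
  refine and_congr_right fun hf => ⟨?_, fun h => ?_⟩
  · rintro ⟨δ, hδ, h⟩
    have h0 : euclNorm (0 : Fin n → ℝ) < δ := by simpa [euclNorm] using hδ
    filter_upwards [continuous_euclNorm.continuousAt.eventually_lt_const h0] with y hy hy1 hy0
    have := h (xs + y) (by rw [qf1_add hA1, hf, hy1, add_zero]) (by simpa using hy0)
      (by simpa using hy)
    rw [qf0_add hA0] at this
    linarith
  · obtain ⟨δ, hδ, h⟩ := Metric.eventually_nhds_iff.1 h
    refine ⟨δ, hδ, fun x hx hne hlt => ?_⟩
    obtain ⟨y, rfl⟩ : ∃ y, x = xs + y := ⟨x - xs, by simp⟩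
    rw [qf1_add hA1, hf, zero_add] at hx
    rw [add_sub_cancel_left] at hlt
    have := h (y := y) (by simpa using (norm_le_euclNorm y).trans_lt hlt) hx (by simpa using hne)
    rw [qf0_add hA0]
    linarith

lemma isGlobalMinGTRE_iff {A0 A1 : Matrix (Fin n) (Fin n) ℝ} (hA0 : A0.IsSymm)
    (hA1 : A1.IsSymm) (b0 b1 : Fin n → ℝ) (c1 : ℝ) (xs : Fin n → ℝ) :
    IsGlobalMinGTRE A0 A1 b0 b1 c1 xs ↔ qf1 A1 b1 c1 xs = 0 ∧
      ∀ y, y ⬝ᵥ A1 *ᵥ y + 2 * ((A1 *ᵥ xs + b1) ⬝ᵥ y) = 0 →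
        0 ≤ y ⬝ᵥ A0 *ᵥ y + 2 * ((A0 *ᵥ xs + b0) ⬝ᵥ y) := by
  refine and_congr_right fun hf => ?_
  rw [← (Equiv.addLeft xs).forall_congr_right]
  simp [qf1_add hA1, qf0_add hA0, hf]

lemma eventually_neg_nhds_zero {P : ℝ → Prop} (h : ∀ᶠ ε in 𝓝 0, P ε) :
    ∀ᶠ ε in 𝓝 (0 : ℝ), P (-ε) :=
  (continuous_neg.tendsto' (0 : ℝ) 0 neg_zero).eventually h

lemma exists_ne_zero_of_eventually {P : ℝ → Prop} (h : ∀ᶠ ε in 𝓝 0, P ε) :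
    ∃ ε, ε ≠ 0 ∧ P ε := by
  obtain ⟨ε, h1, h2⟩ := ((h.filter_mono nhdsWithin_le_nhds).and
    (self_mem_nhdsWithin : {0}ᶜ ∈ 𝓝[≠] (0 : ℝ))).exists
  exact ⟨ε, h2, h1⟩

/-- On a line through the origin contained in the constraint set, a quadratic with a strict local
minimum at the origin has no linear part and is positive. -/
lemma quadForm_pos_of_isotropic {A B : Matrix (Fin n) (Fin n) ℝ} {g h v : Fin n → ℝ}
    (hloc : ∀ᶠ y in 𝓝 (0 : Fin n → ℝ), y ⬝ᵥ A *ᵥ y + 2 * (g ⬝ᵥ y) = 0 → y ≠ 0 →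
      0 < y ⬝ᵥ B *ᵥ y + 2 * (h ⬝ᵥ y))
    (hv : v ≠ 0) (hgv : g ⬝ᵥ v = 0) (hA : v ⬝ᵥ A *ᵥ v = 0) :
    h ⬝ᵥ v = 0 ∧ 0 < v ⬝ᵥ B *ᵥ v := by
  have ht : Tendsto (fun s : ℝ => s • v) (𝓝 0) (𝓝 0) :=
    Continuous.tendsto' (by fun_prop) _ _ (zero_smul ℝ v)
  have hpos : ∀ᶠ s in 𝓝 (0 : ℝ), s ≠ 0 →
      0 < s ^ 2 * (v ⬝ᵥ B *ᵥ v) + 2 * (s * (h ⬝ᵥ v)) := by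
    filter_upwards [ht.eventually hloc] with s hs hs0
    have := hs (by rw [quadForm_smul, hA, dotProduct_smul, hgv]; simp) (smul_ne_zero hs0 hv)
    rwa [quadForm_smul, dotProduct_smul, smul_eq_mul] at this
  have hpos' := hpos.and (eventually_neg_nhds_zero hpos)
  constructor
  · by_contra hl
    have hsmall : ∀ᶠ s in 𝓝 (0 : ℝ), (s * (v ⬝ᵥ B *ᵥ v)) ^ 2 < (2 * (h ⬝ᵥ v)) ^ 2 := by
      have hc : Continuous fun s : ℝ => (s * (v ⬝ᵥ B *ᵥ v)) ^ 2 := by fun_prop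
      refine hc.continuousAt.eventually_lt_const ?_
      have : 0 < (2 * (h ⬝ᵥ v)) ^ 2 := by positivity
      simpa using this
    obtain ⟨s, hs, ⟨h1, h2⟩, h3⟩ := exists_ne_zero_of_eventually (hpos'.and hsmall)
    have h4 := mul_pos (h1 hs) (h2 (neg_ne_zero.2 hs))
    have h5 := mul_lt_mul_of_pos_left h3 (sq_pos_of_ne_zero hs)
    linarith
  · obtain ⟨s, hs, h1, h2⟩ := exists_ne_zero_of_eventually hpos'
    have h3 : 0 < s ^ 2 * (v ⬝ᵥ B *ᵥ v) := by linarith [h1 hs, h2 (neg_ne_zero.2 hs)]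
    exact pos_of_mul_pos_right h3 (sq_nonneg s)

/-- Each line spanned by `d = v + ε • u` meets the constraint set in a second point `r • d`, which
tends to the origin as `ε → 0`. -/
lemma eventually_pos_of_anisotropic {A B : Matrix (Fin n) (Fin n) ℝ}
    {g h v u : Fin n → ℝ}
    (hloc : ∀ᶠ y in 𝓝 (0 : Fin n → ℝ), y ⬝ᵥ A *ᵥ y + 2 * (g ⬝ᵥ y) = 0 → y ≠ 0 →
      0 < y ⬝ᵥ B *ᵥ y + 2 * (h ⬝ᵥ y))
    (hgv : g ⬝ᵥ v = 0) (hA : v ⬝ᵥ A *ᵥ v ≠ 0) (hgu : g ⬝ᵥ u ≠ 0) :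
    ∃ r : ℝ → ℝ, Tendsto r (𝓝 0) (𝓝 0) ∧ (∀ᶠ ε in 𝓝 (0 : ℝ), ε ≠ 0 → r ε * r (-ε) < 0) ∧
      ∀ᶠ ε in 𝓝 (0 : ℝ), ε ≠ 0 →
        0 < r ε * (r ε * ((v + ε • u) ⬝ᵥ B *ᵥ (v + ε • u)) + 2 * (h ⬝ᵥ (v + ε • u))) := by
  set D : ℝ → ℝ := fun ε => (v + ε • u) ⬝ᵥ A *ᵥ (v + ε • u) with hD
  have hDc : Continuous D := (continuous_quadForm A).comp (by fun_prop)
  have hD0 : D 0 = v ⬝ᵥ A *ᵥ v := by simp [hD]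
  have hDpos : ∀ᶠ ε in 𝓝 (0 : ℝ), 0 < D ε * D 0 :=
    (hDc.mul continuous_const).continuousAt.eventually_const_lt (mul_self_pos.2 (hD0 ▸ hA))
  set r : ℝ → ℝ := fun ε => -2 * ε * (g ⬝ᵥ u) / D ε with hr
  have hrt : Tendsto r (𝓝 0) (𝓝 0) := by
    have : ContinuousAt r 0 := by
      refine ContinuousAt.div (by fun_prop) hDc.continuousAt (hD0 ▸ hA)
    simpa [hr, ContinuousAt] using this
  have hdt : Tendsto (fun ε : ℝ => r ε • (v + ε • u)) (𝓝 0) (𝓝 0) := by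
    have : Tendsto (fun ε : ℝ => v + ε • u) (𝓝 0) (𝓝 v) :=
      Continuous.tendsto' (by fun_prop) _ _ (by simp)
    simpa using hrt.smul this
  refine ⟨r, hrt, ?_, ?_⟩
  · filter_upwards [hDpos, eventually_neg_nhds_zero hDpos] with ε h1 h2 hε
    have h3 : 0 < D ε * D (-ε) := by
      have : 0 < D ε * D (-ε) * (D 0 * D 0) := by nlinarith
      exact pos_of_mul_pos_left this (mul_self_nonneg _)
    have : r ε * r (-ε) = -((2 * ε * (g ⬝ᵥ u)) ^ 2 / (D ε * D (-ε))) := by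
      simp only [hr]; rw [div_mul_div_comm]; ring
    rw [this]
    have : 2 * ε * (g ⬝ᵥ u) ≠ 0 := by simp [hε, hgu]
    have := sq_pos_of_ne_zero this
    exact neg_neg_of_pos (by positivity)
  · filter_upwards [hDpos, hdt.eventually hloc] with ε h1 h2 hε
    have hDε : D ε ≠ 0 := left_ne_zero_of_mul h1.ne'
    have hrε : r ε ≠ 0 := by simp [hr, hε, hgu, hDε]
    have hd : v + ε • u ≠ 0 := by
      intro h0
      exact hDε (by simp [hD, h0])
    have hrD : r ε * D ε = -2 * ε * (g ⬝ᵥ u) := div_mul_cancel₀ _ hDε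
    have := h2 (by
      rw [quadForm_smul, dotProduct_smul, smul_eq_mul, dotProduct_add, dotProduct_smul,
        smul_eq_mul, hgv]
      change r ε ^ 2 * D ε + _ = 0
      linear_combination r ε * hrD) (smul_ne_zero hrε hd)
    rw [quadForm_smul, dotProduct_smul, smul_eq_mul] at this
    linarith

/-- First-order necessary condition. -/
lemma dotProduct_nonneg_of_eventually_pos {A B : Matrix (Fin n) (Fin n) ℝ} {g h v : Fin n → ℝ}
    (hg : g ≠ 0)
    (hloc : ∀ᶠ y in 𝓝 (0 : Fin n → ℝ), y ⬝ᵥ A *ᵥ y + 2 * (g ⬝ᵥ y) = 0 → y ≠ 0 →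
      0 < y ⬝ᵥ B *ᵥ y + 2 * (h ⬝ᵥ y))
    (hgv : g ⬝ᵥ v = 0) : 0 ≤ h ⬝ᵥ v := by
  by_contra! hhv
  have hv : v ≠ 0 := by rintro rfl; simp at hhv
  by_cases hA : v ⬝ᵥ A *ᵥ v = 0
  · exact hhv.ne (quadForm_pos_of_isotropic hloc hv hgv hA).1
  · obtain ⟨r, hr, hr2, h1⟩ := eventually_pos_of_anisotropic hloc hgv hA
      (fun h => hg (dotProduct_self_eq_zero.1 h))
    have hc : Tendsto (fun ε => r ε * ((v + ε • g) ⬝ᵥ B *ᵥ (v + ε • g))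
        + 2 * (h ⬝ᵥ (v + ε • g))) (𝓝 0) (𝓝 (2 * (h ⬝ᵥ v))) := by
      have hq : Tendsto (fun ε : ℝ => (v + ε • g) ⬝ᵥ B *ᵥ (v + ε • g)) (𝓝 0)
          (𝓝 (v ⬝ᵥ B *ᵥ v)) :=
        ((continuous_quadForm B).comp (by fun_prop : Continuous fun ε : ℝ => v + ε • g)).tendsto'
          _ _ (by simp)
      have hl : Tendsto (fun ε : ℝ => 2 * (h ⬝ᵥ (v + ε • g))) (𝓝 0) (𝓝 (2 * (h ⬝ᵥ v))) := by
        simp only [dotProduct_add, dotProduct_smul, smul_eq_mul]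
        exact Continuous.tendsto' (by fun_prop) _ _ (by simp)
      simpa using (hr.mul hq).add hl
    have h2 := hc.eventually_lt_const (by linarith : 2 * (h ⬝ᵥ v) < 0)
    obtain ⟨ε, hε, h1, h2, h3, h4, h5⟩ := exists_ne_zero_of_eventually
      (h1.and (h2.and ((eventually_neg_nhds_zero h1).and ((eventually_neg_nhds_zero h2).and hr2))))
    have h6 := neg_of_mul_pos_left (h1 hε) h2.le
    have h7 := neg_of_mul_pos_left (h3 (neg_ne_zero.2 hε)) h4.le
    exact (h5 hε).not_gt (mul_pos_of_neg_of_neg h6 h7)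

lemma exists_multiplier {g h : Fin n → ℝ} (hg : g ≠ 0)
    (H : ∀ v, g ⬝ᵥ v = 0 → 0 ≤ h ⬝ᵥ v) : ∃ μ : ℝ, h + μ • g = 0 := by
  have hgg : g ⬝ᵥ g ≠ 0 := fun h => hg (dotProduct_self_eq_zero.1 h)
  refine ⟨-(g ⬝ᵥ h / g ⬝ᵥ g), dotProduct_self_eq_zero.1 ?_⟩
  set μ := -(g ⬝ᵥ h / g ⬝ᵥ g) with hμ
  have h0 : g ⬝ᵥ (h + μ • g) = 0 := by
    rw [dotProduct_add, dotProduct_smul, smul_eq_mul, hμ]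
    field_simp
    ring
  have h1 := H (-(h + μ • g)) (by rw [dotProduct_neg, h0, neg_zero])
  rw [dotProduct_neg] at h1
  have h2 : (h + μ • g) ⬝ᵥ (h + μ • g) = h ⬝ᵥ (h + μ • g) := by
    conv_lhs => rw [add_dotProduct, smul_dotProduct, h0, smul_zero, add_zero]
  have h3 : 0 ≤ (h + μ • g) ⬝ᵥ (h + μ • g) :=
    Finset.sum_nonneg fun i _ => mul_self_nonneg _
  linarith

lemma exists_quadForm_neg_dotProduct_ne_zero {M : Matrix (Fin n) (Fin n) ℝ} {g u : Fin n → ℝ}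
    (hg : g ≠ 0) (hu : u ⬝ᵥ M *ᵥ u < 0) : ∃ w, w ⬝ᵥ M *ᵥ w < 0 ∧ g ⬝ᵥ w ≠ 0 := by
  by_cases hgu : g ⬝ᵥ u = 0
  · have hc : Continuous fun ε : ℝ => (u + ε • g) ⬝ᵥ M *ᵥ (u + ε • g) :=
      (continuous_quadForm M).comp (by fun_prop)
    obtain ⟨ε, hε, h⟩ := exists_ne_zero_of_eventually
      (hc.continuousAt.eventually_lt_const (by simpa using hu))
    exact ⟨_, h, by simp [dotProduct_add, hgu, hε, hg]⟩
  · exact ⟨u, hu, hgu⟩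

/-- Strict second-order necessary condition: only a vector where the Hessian of the Lagrangian is
negative can rule out degenerate tangent directions. -/
lemma quadForm_pos_of_eventually_pos {A M : Matrix (Fin n) (Fin n) ℝ} (hM : M.IsSymm)
    {g v u : Fin n → ℝ}
    (hloc : ∀ᶠ y in 𝓝 (0 : Fin n → ℝ), y ⬝ᵥ A *ᵥ y + 2 * (g ⬝ᵥ y) = 0 → y ≠ 0 →
      0 < y ⬝ᵥ M *ᵥ y)
    (hg : g ≠ 0) (hu : u ⬝ᵥ M *ᵥ u < 0) (hv : v ≠ 0) (hgv : g ⬝ᵥ v = 0) :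
    0 < v ⬝ᵥ M *ᵥ v := by
  by_contra! hneg
  have hloc' : ∀ᶠ y in 𝓝 (0 : Fin n → ℝ), y ⬝ᵥ A *ᵥ y + 2 * (g ⬝ᵥ y) = 0 → y ≠ 0 →
      0 < y ⬝ᵥ M *ᵥ y + 2 * ((0 : Fin n → ℝ) ⬝ᵥ y) := by simpa using hloc
  by_cases hA : v ⬝ᵥ A *ᵥ v = 0
  · exact (quadForm_pos_of_isotropic hloc' hv hgv hA).2.not_ge hneg
  · obtain ⟨w, hw, hgw⟩ := exists_quadForm_neg_dotProduct_ne_zero hg hu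
    obtain ⟨r, -, -, h⟩ := eventually_pos_of_anisotropic hloc' hgv hA hgw
    obtain ⟨ε, hε, h1, h2⟩ := exists_ne_zero_of_eventually (h.and (eventually_neg_nhds_zero h))
    have h1 := h1 hε
    have h2 := h2 (neg_ne_zero.2 hε)
    rw [zero_dotProduct, mul_zero, add_zero, ← mul_assoc] at h1 h2
    have h3 := pos_of_mul_pos_right h1 (mul_self_nonneg _)
    have h4 := pos_of_mul_pos_right h2 (mul_self_nonneg _)
    rw [hM.quadForm_add_smul] at h3 h4
    nlinarith [mul_nonneg (sq_nonneg ε) (neg_nonneg.2 hw.le)]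

/-- Second-order sufficient condition. -/
lemma eventually_pos_of_quadForm_pos {A M : Matrix (Fin n) (Fin n) ℝ} {g : Fin n → ℝ}
    (H : ∀ v, v ≠ 0 → g ⬝ᵥ v = 0 → 0 < v ⬝ᵥ M *ᵥ v) :
    ∀ᶠ y in 𝓝 (0 : Fin n → ℝ), y ⬝ᵥ A *ᵥ y + 2 * (g ⬝ᵥ y) = 0 → y ≠ 0 →
      0 < y ⬝ᵥ M *ᵥ y := by
  set K : Set (Fin n → ℝ) := Metric.sphere 0 1 ∩ {v | v ⬝ᵥ M *ᵥ v ≤ 0} with hK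
  have hKc : IsCompact K :=
    (isCompact_sphere 0 1).inter_right (isClosed_le (continuous_quadForm M) continuous_const)
  have hev : ∀ᶠ ρ in 𝓝 (0 : ℝ), ∀ v ∈ K, ρ * (v ⬝ᵥ A *ᵥ v) + 2 * (g ⬝ᵥ v) ≠ 0 := by
    refine hKc.eventually_forall_of_forall_eventually fun v hv => ?_
    have hc : Continuous fun z : ℝ × (Fin n → ℝ) =>
        z.1 * (z.2 ⬝ᵥ A *ᵥ z.2) + 2 * (g ⬝ᵥ z.2) :=
      (continuous_fst.mul ((continuous_quadForm A).comp continuous_snd)).add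
        (continuous_const.mul (continuous_const.dotProduct continuous_snd))
    refine hc.continuousAt.eventually_ne ?_
    have hgv : g ⬝ᵥ v ≠ 0 := fun h =>
      (H v (by rintro rfl; simp [hK] at hv) h).not_ge hv.2
    simpa using hgv
  filter_upwards [(continuous_norm.tendsto' (0 : Fin n → ℝ) 0 norm_zero).eventually hev]
    with y hy hy1 hy0
  by_contra! hneg
  have hρ : ‖y‖ ≠ 0 := norm_ne_zero_iff.2 hy0
  refine hy (‖y‖⁻¹ • y) ⟨by simp [norm_smul, hρ], ?_⟩ ?_
  · rw [Set.mem_ofPred_eq, quadForm_smul]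
    exact mul_nonpos_of_nonneg_of_nonpos (sq_nonneg _) hneg
  · rw [quadForm_smul, dotProduct_smul, smul_eq_mul]
    field_simp
    linarith

lemma Matrix.IsSymm.exists_quadForm_ne_zero {A : Matrix (Fin n) (Fin n) ℝ} (hA : A.IsSymm)
    (h : A ≠ 0) : ∃ u, u ⬝ᵥ A *ᵥ u ≠ 0 := by
  by_contra! H
  refine h (Matrix.ext fun i j => ?_)
  have := hA.quadForm_add_smul (Pi.single i 1) (Pi.single j 1) 1
  rw [H, H, H] at this
  simpa using this

lemma exists_quadForm_neg_quadForm_ne_zero {A M : Matrix (Fin n) (Fin n) ℝ} (hA : A.IsSymm)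
    (h : A ≠ 0) {w : Fin n → ℝ} (hw : w ⬝ᵥ M *ᵥ w < 0) :
    ∃ d, d ⬝ᵥ M *ᵥ d < 0 ∧ d ⬝ᵥ A *ᵥ d ≠ 0 := by
  by_cases hwA : w ⬝ᵥ A *ᵥ w = 0
  · obtain ⟨u, hu⟩ := hA.exists_quadForm_ne_zero h
    have hc : Continuous fun ε : ℝ => (w + ε • u) ⬝ᵥ M *ᵥ (w + ε • u) :=
      (continuous_quadForm M).comp (by fun_prop)
    obtain ⟨ε, hε, h1, h2⟩ := exists_ne_zero_of_eventually
      (have hn := hc.continuousAt.eventually_lt_const (by simpa using hw)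
       hn.and (eventually_neg_nhds_zero hn))
    by_contra! H
    have h3 := H _ h1
    have h4 := H _ h2
    rw [hA.quadForm_add_smul, hwA] at h3 h4
    have : ε ^ 2 * (u ⬝ᵥ A *ᵥ u) = 0 := by linarith
    exact mul_ne_zero (pow_ne_zero 2 hε) hu this
  · exact ⟨w, hw, hwA⟩

end QuadraticForms

theorem stmt8 {n : ℕ} (hn : 1 ≤ n)
    (A0 A1 : Matrix (Fin n) (Fin n) ℝ) (hA0 : A0.IsSymm) (hA1 : A1.IsSymm)
    (b0 b1 : Fin n → ℝ) (c1 : ℝ) (xs : Fin n → ℝ) :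
    IsStrictLNGMinGTRE A0 A1 b0 b1 c1 xs ↔
      (qf1 A1 b1 c1 xs = 0 ∧
       (∃ μ : ℝ,
          (A0.mulVec xs + b0) + μ • (A1.mulVec xs + b1) = 0 ∧
          (∀ v : Fin n → ℝ, v ≠ 0 → (A1.mulVec xs + b1) ⬝ᵥ v = 0 →
            0 < v ⬝ᵥ (A0 + μ • A1).mulVec v) ∧
          ¬ (A0 + μ • A1).PosSemidef) ∧
       A1 ≠ 0) := by
  set g := A1 *ᵥ xs + b1 with hg_def
  set h := A0 *ᵥ xs + b0 with hh_def
  have hMsymm (μ : ℝ) : (A0 + μ • A1).IsSymm := hA0.add (hA1.smul μ)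
  have lagrange {μ : ℝ} (hμ : h + μ • g = 0) {y : Fin n → ℝ}
      (hy : y ⬝ᵥ A1 *ᵥ y + 2 * (g ⬝ᵥ y) = 0) :
      y ⬝ᵥ A0 *ᵥ y + 2 * (h ⬝ᵥ y) = y ⬝ᵥ (A0 + μ • A1) *ᵥ y := by
    have : h ⬝ᵥ y + μ * (g ⬝ᵥ y) = 0 := by
      simpa [add_dotProduct] using congrArg (· ⬝ᵥ y) hμ
    rw [quadForm_add_smul_matrix]
    linear_combination 2 * this - μ * hy
  rw [IsStrictLNGMinGTRE, isStrictLocalMinGTRE_iff hA0 hA1, isGlobalMinGTRE_iff hA0 hA1,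
    and_assoc]
  refine and_congr_right fun hf => ?_
  simp only [hf, true_and, ← hg_def, ← hh_def]
  constructor
  · rintro ⟨hloc, hng⟩
    have hcone (H : ∀ y, y ⬝ᵥ A1 *ᵥ y + 2 * (g ⬝ᵥ y) = 0 → g ⬝ᵥ y = 0) : False := by
      refine hng fun y hy => ?_
      rcases eq_or_ne y 0 with rfl | hy0
      · simp
      have hgy := H y hy
      obtain ⟨h0, hB⟩ := quadForm_pos_of_isotropic hloc hy0 hgy (by linarith)
      rw [h0, mul_zero, add_zero]
      exact hB.le
    have hg : g ≠ 0 := fun h0 => hcone fun y _ => by rw [h0, zero_dotProduct]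
    obtain ⟨μ, hμ⟩ := exists_multiplier hg fun v hv =>
      dotProduct_nonneg_of_eventually_pos hg hloc hv
    have hnpsd : ¬ (A0 + μ • A1).PosSemidef := fun hM => hng fun y hy => by
      rw [lagrange hμ hy]
      exact (hMsymm μ).posSemidef_iff.1 hM y
    have hlocM : ∀ᶠ y in 𝓝 (0 : Fin n → ℝ), y ⬝ᵥ A1 *ᵥ y + 2 * (g ⬝ᵥ y) = 0 → y ≠ 0 →
        0 < y ⬝ᵥ (A0 + μ • A1) *ᵥ y := by
      filter_upwards [hloc] with y hy hy1 hy0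
      rw [← lagrange hμ hy1]
      exact hy hy1 hy0
    obtain ⟨u, hu⟩ : ∃ u, u ⬝ᵥ (A0 + μ • A1) *ᵥ u < 0 := by
      simpa [(hMsymm μ).posSemidef_iff] using hnpsd
    refine ⟨⟨μ, hμ, fun v hv hgv => ?_, hnpsd⟩, fun hA => hcone fun y hy => ?_⟩
    · exact quadForm_pos_of_eventually_pos (hMsymm μ) hlocM hg hu hv hgv
    · rw [hA, zero_mulVec, dotProduct_zero] at hy
      linarith
  · rintro ⟨⟨μ, hμ, hpos, hnpsd⟩, hA1ne⟩
    refine ⟨?_, fun hglob => hnpsd ((hMsymm μ).posSemidef_iff.2 ?_)⟩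
    · filter_upwards [eventually_pos_of_quadForm_pos (A := A1) hpos] with y hy hy1 hy0
      rw [lagrange hμ hy1]
      exact hy hy1 hy0
    · by_contra! ⟨w, hw⟩
      obtain ⟨d, hd, hdA⟩ := exists_quadForm_neg_quadForm_ne_zero hA1 hA1ne hw
      have hgd : g ⬝ᵥ d ≠ 0 := fun h0 =>
        (hpos d (by rintro rfl; simp at hd) h0).not_gt hd
      have hfeas : ((-2 * (g ⬝ᵥ d) / (d ⬝ᵥ A1 *ᵥ d)) • d) ⬝ᵥ A1 *ᵥ
          ((-2 * (g ⬝ᵥ d) / (d ⬝ᵥ A1 *ᵥ d)) • d)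
          + 2 * (g ⬝ᵥ ((-2 * (g ⬝ᵥ d) / (d ⬝ᵥ A1 *ᵥ d)) • d)) = 0 := by
        rw [quadForm_smul, dotProduct_smul, smul_eq_mul]
        field_simp
        ring
      have := hglob _ hfeas
      rw [lagrange hμ hfeas, quadForm_smul] at this
      have hr : -2 * (g ⬝ᵥ d) / (d ⬝ᵥ A1 *ᵥ d) ≠ 0 := by simp [hgd, hdA]
      nlinarith [sq_pos_of_ne_zero hr]
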